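/- Let E be an arbitrary directed graph, {t_e, p_v} a Cuntz-Krieger E-family, and for i ≥ 0 let F_i be the closed span of {t_μ t_ν* : |μ|=|ν|=i, s(μ)=s(ν)} (with F_0 the closed span of the p_v). Then for every i, the sum C_i := F_0 + F_1 + ⋯ + F_i is a C*-subalgebra of the gauge-fixed point algebra, C_i ⊆ C_{i+1}, and the union ⋃_i C_i is dense in the core C*(E)^γ (the fixed-point algebra of the gauge action). -/

import Mathlib

/-- `μ : Fin k → E1` is a path (edges composing left-to-right as `μ₁μ₂⋯μ_k` with
`s(μᵢ) = r(μᵢ₊₁)`) from source vertex `v` (the source of the last edge) to range vertex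
`w` (the range of the first edge); a path of length `0` is a vertex, and then `v = w`. -/
structure IsPathFromTo {E0 E1 : Type*} (r s : E1 → E0) {k : ℕ}
    (μ : Fin k → E1) (v w : E0) : Prop where
  chain : ∀ (i : ℕ) (h : i + 1 < k), s (μ ⟨i, by omega⟩) = r (μ ⟨i + 1, h⟩)
  rng : ∀ h : 0 < k, r (μ ⟨0, h⟩) = w
  src : ∀ h : 0 < k, s (μ ⟨k - 1, by omega⟩) = v
  deg : k = 0 → w = v

/-- The partial isometry `t_μ = t_{μ₁} ⋯ t_{μ_k}` associated to a path `μ` with range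
vertex `w`; for a genuine path the leading factor `p w` is redundant, and for the empty
path (a vertex) `t_μ = p w`. -/
def tPath {E0 E1 B : Type*} [Monoid B] (p : E0 → B) (t : E1 → B) {k : ℕ}
    (w : E0) (μ : Fin k → E1) : B :=
  p w * (List.ofFn fun i => t (μ i)).prod


/-- `F_i`: the closed span of `{t_μ t_ν* : |μ| = |ν| = i, s(μ) = s(ν)}`. -/
noncomputable def graphF {E0 E1 B : Type*} [CStarAlgebra B]
    (r s : E1 → E0) (p : E0 → B) (t : E1 → B) (i : ℕ) : Submodule ℂ B :=
  (Submodule.span ℂ {x : B | ∃ (μ ν : Fin i → E1) (v wμ wν : E0),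
    IsPathFromTo r s μ v wμ ∧ IsPathFromTo r s ν v wν ∧
    x = tPath p t wμ μ * star (tPath p t wν ν)}).topologicalClosure

/-- `C_i = F_0 + F_1 + ⋯ + F_i`. -/
noncomputable def graphC {E0 E1 B : Type*} [CStarAlgebra B]
    (r s : E1 → E0) (p : E0 → B) (t : E1 → B) (i : ℕ) : Submodule ℂ B :=
  ⨆ j : Fin (i + 1), graphF r s p t (j : ℕ)

/-- The core: the closed span of all `t_μ t_ν*` with `|μ| = |ν|`. -/
noncomputable def graphCore {E0 E1 B : Type*} [CStarAlgebra B]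
    (r s : E1 → E0) (p : E0 → B) (t : E1 → B) : Submodule ℂ B :=
  (⨆ i : ℕ, graphF r s p t i).topologicalClosure

/-- The idealizer of a star-closed subspace closed under multiplication. -/
def idl {B : Type*} [CStarAlgebra B] (I : Submodule ℂ B)
    (hst : ∀ x ∈ I, star x ∈ I) : StarSubalgebra ℂ B where
  carrier := {x | ∀ i ∈ I, x * i ∈ I ∧ i * x ∈ I}
  mul_mem' := by
    intro a b ha hb i hi
    refine ⟨?_, ?_⟩
    · rw [mul_assoc]; exact (ha _ (hb i hi).1).1
    · rw [← mul_assoc]; exact (hb _ (ha i hi).2).2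
  add_mem' := by
    intro a b ha hb i hi
    rw [add_mul, mul_add]
    exact ⟨I.add_mem (ha i hi).1 (hb i hi).1, I.add_mem (ha i hi).2 (hb i hi).2⟩
  algebraMap_mem' := by
    intro c i hi
    rw [Algebra.algebraMap_eq_smul_one, smul_mul_assoc, mul_smul_comm, one_mul, mul_one]
    exact ⟨I.smul_mem c hi, I.smul_mem c hi⟩
  star_mem' := by
    intro a ha i hi
    have h := ha _ (hst i hi)
    refine ⟨?_, ?_⟩
    · simpa using hst _ h.2
    · simpa using hst _ h.1

theorem idl_closed {B : Type*} [CStarAlgebra B] (I : Submodule ℂ B)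
    (hst : ∀ x ∈ I, star x ∈ I) (hcl : IsClosed (I : Set B)) :
    IsClosed (idl I hst : Set B) := by
  have : (idl I hst : Set B) = ⋂ i ∈ I, ({x | x * i ∈ (I : Set B)} ∩ {x | i * x ∈ (I : Set B)}) := by
    ext x
    simp [idl]
  rw [this]
  refine isClosed_biInter fun i _ => IsClosed.inter ?_ ?_
  · exact hcl.preimage (by fun_prop)
  · exact hcl.preimage (by fun_prop)

theorem mem_of_sq_le {B : Type*} [CStarAlgebra B] [PartialOrder B] [StarOrderedRing B]
    (I : Submodule ℂ B)
    (hst : ∀ x ∈ I, star x ∈ I) (hcl : IsClosed (I : Set B))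
    (hmul : ∀ x ∈ I, ∀ y ∈ I, x * y ∈ I)
    (u w : B) (hu : ∀ i ∈ I, u * i ∈ I) (hw : w ∈ I) (huw : star u * u ≤ w) : u ∈ I := by
  have hw0 : 0 ≤ w := (star_mul_self_nonneg u).trans huw
  have hwsa : IsSelfAdjoint w := .of_nonneg hw0
  have hsp : ∀ x ∈ spectrum ℝ w, 0 ≤ x := fun x hx => spectrum_nonneg_of_nonneg hw0 hx
  have key : ∀ ε : ℝ, 0 < ε → ∃ y ∈ I, ‖u - y‖ ^ 2 ≤ ε := by
    intro ε hε
    have hg : ContinuousOn (fun x : ℝ => (x + ε)⁻¹) (spectrum ℝ w) := by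
      apply ContinuousOn.inv₀ (by fun_prop)
      intro x hx
      have := hsp x hx
      positivity
    have hk : ContinuousOn (fun x : ℝ => ε * (x + ε)⁻¹) (spectrum ℝ w) := by fun_prop
    set g := cfc (fun x : ℝ => (x + ε)⁻¹) w with hgdef
    set k := cfc (fun x : ℝ => ε * (x + ε)⁻¹) w with hkdef
    have hgD : g ∈ idl I hst := by
      have := idl_closed I hst hcl
      exact cfc_mem (𝕜' := ℂ) _ (show w ∈ idl I hst from
        fun i hi => ⟨hmul _ hw _ hi, hmul _ hi _ hw⟩)
    have he : w * g ∈ I := (hgD w hw).2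
    have h1 : k = 1 - w * g := by
      rw [hkdef, hgdef]
      conv_rhs => rw [← cfc_one ℝ w]
      nth_rewrite 3 [← cfc_id' ℝ w]
      rw [← cfc_mul _ _ w, ← cfc_sub _ _ w]
      apply cfc_congr
      intro x hx
      have := hsp x hx
      have h2 : x + ε ≠ 0 := by positivity
      simp only [Pi.one_apply]
      field_simp
      ring
    have hksa : star k = k := (cfc_predicate (R := ℝ) _ w : IsSelfAdjoint k)
    refine ⟨u * (w * g), hu _ he, ?_⟩
    have h3 : u - u * (w * g) = u * k := by rw [h1]; noncomm_ring
    rw [h3, pow_two, ← CStarRing.norm_star_mul_self, star_mul, hksa]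
    have h4 : k * star u * (u * k) = star k * (star u * u) * k := by rw [hksa]; noncomm_ring
    rw [h4]
    have h5 := star_left_conjugate_le_conjugate huw k
    have h6 := CStarAlgebra.norm_le_norm_of_nonneg_of_le
      (star_left_conjugate_nonneg (star_mul_self_nonneg u) k) h5
    refine h6.trans ?_
    have h7 : star k * w * k = cfc (fun x : ℝ => (ε * (x + ε)⁻¹) * x * (ε * (x + ε)⁻¹)) w := by
      rw [cfc_mul (fun x : ℝ => (ε * (x + ε)⁻¹) * x) (fun x : ℝ => ε * (x + ε)⁻¹) w
        (hk.mul continuousOn_id) hk,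
        cfc_mul (fun x : ℝ => ε * (x + ε)⁻¹) (fun x : ℝ => x) w hk continuousOn_id,
        cfc_id' ℝ w, hksa]
    rw [h7]
    apply norm_cfc_le hε.le
    intro x hx
    have hx0 := hsp x hx
    have h8 : 0 ≤ (ε * (x + ε)⁻¹) * x * (ε * (x + ε)⁻¹) := by positivity
    rw [Real.norm_of_nonneg h8]
    have h9 : (ε * (x + ε)⁻¹) * x * (ε * (x + ε)⁻¹) = ε ^ 2 * x / (x + ε) ^ 2 := by
      field_simp
    rw [h9, div_le_iff₀ (by positivity)]
    nlinarith [mul_nonneg hε.le (mul_nonneg hx0 hx0), mul_nonneg (mul_nonneg hε.le hε.le) hx0, pow_pos hε 3]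
  have : u ∈ closure (I : Set B) := by
    rw [Metric.mem_closure_iff]
    intro ε hε
    obtain ⟨y, hy, h⟩ := key ((ε / 2) ^ 2) (by positivity)
    refine ⟨y, hy, ?_⟩
    rw [dist_eq_norm]
    have := abs_le_of_sq_le_sq h (by positivity)
    rw [abs_of_nonneg (norm_nonneg _)] at this
    linarith
  rwa [hcl.closure_eq] at this

/-- A subspace viewed as a non-unital star subalgebra. -/
def asNU {B : Type*} [CStarAlgebra B] (A : Submodule ℂ B)
    (hst : ∀ x ∈ A, star x ∈ A) (hmul : ∀ x ∈ A, ∀ y ∈ A, x * y ∈ A) :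
    NonUnitalStarSubalgebra ℂ B where
  __ := A
  mul_mem' := fun ha hb => hmul _ ha _ hb
  star_mem' := fun ha => hst _ ha

theorem exists_inter_sa {B : Type*} [CStarAlgebra B] [PartialOrder B] [StarOrderedRing B]
    (A I : Submodule ℂ B)
    (hAst : ∀ x ∈ A, star x ∈ A) (hAcl : IsClosed (A : Set B))
    (hAmul : ∀ x ∈ A, ∀ y ∈ A, x * y ∈ A)
    (hst : ∀ x ∈ I, star x ∈ I) (hcl : IsClosed (I : Set B))
    (hmul : ∀ x ∈ I, ∀ y ∈ I, x * y ∈ I)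
    (hAI : ∀ x ∈ A, ∀ y ∈ I, x * y ∈ I)
    (a x : B) (ha : a ∈ A) (hsa : IsSelfAdjoint a) (hx : x ∈ I) :
    ∃ y ∈ A, y ∈ I ∧ ‖a - y‖ ≤ ‖a - x‖ := by
  have hIA : ∀ x ∈ A, ∀ y ∈ I, y * x ∈ I := by
    intro x hx y hy
    simpa using hst _ (hAI _ (hAst x hx) _ (hst y hy))
  set δ := ‖a - x‖ with hδ
  have hδ0 : 0 ≤ δ := norm_nonneg _
  set φ : ℝ → ℝ := fun s => s - max (-δ) (min s δ) with hφ
  have hφc : Continuous φ := by fun_prop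
  have hφ0 : φ 0 = 0 := by simp [hφ, hδ0]
  set b := cfc φ a with hb
  have hbA : b ∈ A := by
    rw [hb, ← cfcₙ_eq_cfc (hf0 := hφ0)]
    have : IsClosed (asNU A hAst hAmul : Set B) := hAcl
    exact cfcₙ_mem (𝕜' := ℂ) (s := asNU A hAst hAmul) φ ha
  have hbsa : star b = b := (cfc_predicate (R := ℝ) φ a : IsSelfAdjoint b)
  refine ⟨b, hbA, ?_, ?_⟩
  · have hb2 : b * b ∈ I := by
      set z := star x * a + star a * x - star x * x with hz
      have hzI : z ∈ I := I.sub_mem (I.add_mem (hIA _ ha _ (hst _ hx))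
        (hAI _ (hAst _ ha) _ hx)) (hmul _ (hst _ hx) _ hx)
      apply mem_of_sq_le I hst hcl hmul (b * b) (b * z * b)
      · intro i hi
        exact hAI _ (hAmul _ hbA _ hbA) _ hi
      · exact hIA _ hbA _ (hAI _ hbA _ hzI)
      · have h1 : a * a - algebraMap ℝ B (δ ^ 2) ≤ z := by
          have h2 : star (a - x) * (a - x) ≤ algebraMap ℝ B (δ ^ 2) :=
            CStarAlgebra.star_mul_le_algebraMap_norm_sq
          have h3 : z = a * a - star (a - x) * (a - x) := by
            rw [hz, star_sub, hsa.star_eq]; noncomm_ring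
          rw [h3]
          exact sub_le_sub_left h2 _
        have h4 := star_left_conjugate_le_conjugate h1 b
        rw [hbsa] at h4
        refine le_trans ?_ h4
        rw [star_mul, hbsa]
        have h5 : b * b * (b * b) = cfc (fun s => φ s * φ s * (φ s * φ s)) a := by
          rw [hb, ← cfc_mul _ _ a, ← cfc_mul _ _ a]
        have h6 : b * (a * a - algebraMap ℝ B (δ ^ 2)) * b
            = cfc (fun s => φ s * (s * s - δ ^ 2) * φ s) a := by
          have h7 : a * a - algebraMap ℝ B (δ ^ 2) = cfc (fun s : ℝ => s * s - δ ^ 2) a := by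
            rw [cfc_sub _ _ a, cfc_mul _ _ a, cfc_id' ℝ a, cfc_const _ a]
          rw [h7, hb, ← cfc_mul _ _ a, ← cfc_mul _ _ a]
        rw [h5, h6]
        refine cfc_mono (hf := by fun_prop) (hg := by fun_prop) ?_
        intro s _
        have h8 : φ s * φ s * (φ s * φ s) ≤ φ s * φ s * (s * s - δ ^ 2) := by
          rcases le_total s δ with h | h
          · rcases le_total (-δ) s with h' | h'
            · have : φ s = 0 := by simp [hφ, h, h']
              simp [this]
            · have : φ s = s + δ := by simp [hφ, h, h']
              apply mul_le_mul_of_nonneg_left _ (mul_self_nonneg _)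
              rw [this]; nlinarith
          · have : φ s = s - δ := by
              simp only [hφ, min_eq_right h]; rw [max_eq_right (by linarith)]
            apply mul_le_mul_of_nonneg_left _ (mul_self_nonneg _)
            rw [this]; nlinarith
        linarith
    exact mem_of_sq_le I hst hcl hmul b (b * b) (fun i hi => hAI _ hbA _ hi) hb2 (by rw [hbsa])
  · have h1 : a - b = cfc (fun s => max (-δ) (min s δ)) a := by
      rw [hb]
      nth_rewrite 1 [← cfc_id' ℝ a]
      rw [← cfc_sub _ _ a]
      apply cfc_congr
      intro s _
      simp [hφ]
    rw [h1]
    apply norm_cfc_le hδ0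
    intro s _
    rw [Real.norm_eq_abs, abs_le]
    refine ⟨le_max_left _ _, max_le (by linarith) (min_le_right _ _)⟩

theorem exists_inter {B : Type*} [CStarAlgebra B] [PartialOrder B] [StarOrderedRing B]
    (A I : Submodule ℂ B)
    (hAst : ∀ x ∈ A, star x ∈ A) (hAcl : IsClosed (A : Set B))
    (hAmul : ∀ x ∈ A, ∀ y ∈ A, x * y ∈ A)
    (hst : ∀ x ∈ I, star x ∈ I) (hcl : IsClosed (I : Set B))
    (hmul : ∀ x ∈ I, ∀ y ∈ I, x * y ∈ I)
    (hAI : ∀ x ∈ A, ∀ y ∈ I, x * y ∈ I)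
    (a x : B) (ha : a ∈ A) (hx : x ∈ I) :
    ∃ y ∈ A, y ∈ I ∧ ‖a - y‖ ≤ 2 * ‖a - x‖ := by
  have hsmulA : ∀ z ∈ A, (realPart z : B) ∈ A ∧ (imaginaryPart z : B) ∈ A := by
    intro z hz
    rw [realPart_apply_coe, imaginaryPart_apply_coe]
    have h2 : ∀ c : ℝ, ∀ y ∈ A, c • y ∈ A := fun c y hy => by
      rw [← Complex.coe_smul]; exact A.smul_mem _ hy
    exact ⟨h2 _ _ (A.add_mem hz (hAst _ hz)),
      A.smul_mem _ (h2 _ _ (A.sub_mem hz (hAst _ hz)))⟩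
  have hsmulI : ∀ z ∈ I, (realPart z : B) ∈ I ∧ (imaginaryPart z : B) ∈ I := by
    intro z hz
    rw [realPart_apply_coe, imaginaryPart_apply_coe]
    have h2 : ∀ c : ℝ, ∀ y ∈ I, c • y ∈ I := fun c y hy => by
      rw [← Complex.coe_smul]; exact I.smul_mem _ hy
    exact ⟨h2 _ _ (I.add_mem hz (hst _ hz)),
      I.smul_mem _ (h2 _ _ (I.sub_mem hz (hst _ hz)))⟩
  obtain ⟨y1, h1A, h1I, h1⟩ := exists_inter_sa A I hAst hAcl hAmul hst hcl hmul hAI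
    (realPart a) (realPart x) (hsmulA a ha).1 (realPart a).2 (hsmulI x hx).1
  obtain ⟨y2, h2A, h2I, h2⟩ := exists_inter_sa A I hAst hAcl hAmul hst hcl hmul hAI
    (imaginaryPart a) (imaginaryPart x) (hsmulA a ha).2 (imaginaryPart a).2 (hsmulI x hx).2
  refine ⟨y1 + Complex.I • y2, A.add_mem h1A (A.smul_mem _ h2A),
    I.add_mem h1I (I.smul_mem _ h2I), ?_⟩
  have e1 : ‖(realPart a : B) - realPart x‖ ≤ ‖a - x‖ := by
    have := realPart.norm_le (a - x)
    simpa using this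
  have e2 : ‖(imaginaryPart a : B) - imaginaryPart x‖ ≤ ‖a - x‖ := by
    have := imaginaryPart.norm_le (a - x)
    simpa using this
  have e3 : a - (y1 + Complex.I • y2)
      = ((realPart a : B) - y1) + Complex.I • ((imaginaryPart a : B) - y2) := by
    nth_rewrite 1 [← realPart_add_I_smul_imaginaryPart a]
    rw [smul_sub]; abel
  rw [e3]
  refine (norm_add_le _ _).trans ?_
  rw [norm_smul, Complex.norm_I, one_mul]
  linarith

theorem isClosed_sup {B : Type*} [CStarAlgebra B]
    (A I : Submodule ℂ B)
    (hAst : ∀ x ∈ A, star x ∈ A) (hAcl : IsClosed (A : Set B))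
    (hAmul : ∀ x ∈ A, ∀ y ∈ A, x * y ∈ A)
    (hst : ∀ x ∈ I, star x ∈ I) (hcl : IsClosed (I : Set B))
    (hmul : ∀ x ∈ I, ∀ y ∈ I, x * y ∈ I)
    (hAI : ∀ x ∈ A, ∀ y ∈ I, x * y ∈ I) : IsClosed ((A ⊔ I : Submodule ℂ B) : Set B) := by
  let := CStarAlgebra.spectralOrder B
  have := CStarAlgebra.spectralOrderedRing B
  have : CompleteSpace A := hAcl.completeSpace_coe
  have : CompleteSpace I := hcl.completeSpace_coe
  let f : NormedAddGroupHom (A × I) B :=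
    ((A.subtype.coprod I.subtype).toAddMonoidHom).mkNormedAddGroupHom 2 (by
      rintro ⟨a, i⟩
      have h1 : ‖a‖ ≤ ‖(a, i)‖ := norm_fst_le (a, i)
      have h2 : ‖i‖ ≤ ‖(a, i)‖ := norm_snd_le (a, i)
      have h3 : ‖(a : B) + i‖ ≤ ‖a‖ + ‖i‖ := norm_add_le _ _
      simp only [LinearMap.toAddMonoidHom_coe, LinearMap.coprod_apply, Submodule.subtype_apply]
      linarith)
  have hf : ∀ a i, f (a, i) = (a : B) + i := fun a i => by
    simp [f]
  have hyp : f.SurjectiveOnWith (A ⊔ I).toAddSubgroup 3 := by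
    intro h hh
    obtain ⟨a, ha, i, hi, rfl⟩ := Submodule.mem_sup.1 (show h ∈ A ⊔ I from hh)
    obtain ⟨y, hyA, hyI, hy⟩ := exists_inter A I hAst hAcl hAmul hst hcl hmul hAI a (-i) ha
      (I.neg_mem hi)
    rw [sub_neg_eq_add] at hy
    refine ⟨(⟨a - y, A.sub_mem ha hyA⟩, ⟨i + y, I.add_mem hi hyI⟩), ?_, ?_⟩
    · rw [hf]; simp
    · have h1 : ‖i + y‖ ≤ ‖a + i‖ + ‖a - y‖ := by
        have : i + y = (a + i) - (a - y) := by abel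
        rw [this]; exact norm_sub_le _ _
      rw [Prod.norm_def]
      refine max_le ?_ ?_
      · change ‖a - y‖ ≤ _
        linarith [norm_nonneg (a + i)]
      · change ‖i + y‖ ≤ _
        linarith
  have := controlled_closure_of_complete (ε := 1) (by norm_num) (by norm_num) hyp
  apply isClosed_of_closure_subset
  intro h hh
  obtain ⟨⟨a, i⟩, hg, -⟩ := this h hh
  rw [← hg, hf]
  exact Submodule.add_mem_sup a.2 i.2

/-- List version of paths. -/
def IsP {E0 E1 : Type*} (r s : E1 → E0) : List E1 → E0 → E0 → Prop
  | [], v, w => w = v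
  | e :: l, v, w => r e = w ∧ IsP r s l v (s e)

/-- List version of `tPath`. -/
def TP {E0 E1 B : Type*} [Monoid B] (p : E0 → B) (t : E1 → B) (w : E0) (l : List E1) : B :=
  p w * (l.map t).prod

theorem isP_ofFn {E0 E1 : Type*} (r s : E1 → E0) : ∀ {k : ℕ} (μ : Fin k → E1) (v w : E0),
    IsPathFromTo r s μ v w ↔ IsP r s (List.ofFn μ) v w
  | 0, μ, v, w => by
    simp only [List.ofFn_zero, IsP]
    exact ⟨fun h => h.deg rfl, fun h => ⟨fun i hi => by omega, fun h => by omega,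
      fun h => by omega, fun _ => h⟩⟩
  | k + 1, μ, v, w => by
    rw [List.ofFn_succ, IsP, ← isP_ofFn r s (fun i => μ i.succ) v (s (μ 0))]
    constructor
    · intro h
      refine ⟨h.rng (by omega), ⟨fun i hi => ?_, fun hk => ?_, fun hk => ?_, fun hk => ?_⟩⟩
      · exact h.chain (i + 1) (by omega)
      · exact (h.chain 0 (by omega)).symm
      · rw [← h.src (by omega)]
        congr 2
        ext
        simp
        omega
      · subst hk
        exact h.src (by omega)
    · rintro ⟨h0, h⟩
      refine ⟨fun i hi => ?_, fun hk => h0, fun hk => ?_, fun hk => by omega⟩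
      · rcases i with _ | i
        · exact (h.rng (by omega)).symm
        · exact h.chain i (by omega)
      · rcases Nat.eq_zero_or_pos k with rfl | hk0
        · exact h.deg rfl
        · rw [← h.src hk0]
          congr 2
          ext
          simp
          omega

theorem tPath_eq {E0 E1 B : Type*} [Monoid B] (p : E0 → B) (t : E1 → B) {k : ℕ}
    (w : E0) (μ : Fin k → E1) : tPath p t w μ = TP p t w (List.ofFn μ) := by
  simp only [tPath, TP, List.map_ofFn]
  rfl

/-- The generators of `F_i`. -/
def gens {E0 E1 B : Type*} [CStarAlgebra B]
    (r s : E1 → E0) (p : E0 → B) (t : E1 → B) (i : ℕ) : Set B :=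
  {x : B | ∃ (l m : List E1) (v w w' : E0), l.length = i ∧ m.length = i ∧
    IsP r s l v w ∧ IsP r s m v w' ∧ x = TP p t w l * star (TP p t w' m)}

theorem graphF_eq {E0 E1 B : Type*} [CStarAlgebra B]
    (r s : E1 → E0) (p : E0 → B) (t : E1 → B) (i : ℕ) :
    graphF r s p t i = (Submodule.span ℂ (gens r s p t i)).topologicalClosure := by
  unfold graphF
  congr 2
  ext x
  constructor
  · rintro ⟨μ, ν, v, w, w', h1, h2, rfl⟩
    refine ⟨List.ofFn μ, List.ofFn ν, v, w, w', by simp, by simp, ?_, ?_, ?_⟩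
    · rwa [← isP_ofFn]
    · rwa [← isP_ofFn]
    · rw [tPath_eq, tPath_eq]
  · rintro ⟨l, m, v, w, w', rfl, hm, h1, h2, rfl⟩
    refine ⟨l.get, fun j => m.get (j.cast hm.symm), v, w, w', ?_, ?_, ?_⟩
    · rw [isP_ofFn, List.ofFn_get]; exact h1
    · rw [isP_ofFn]
      have : List.ofFn (fun j : Fin l.length => m.get (j.cast hm.symm)) = m := by
        apply List.ext_get
        · simp [hm]
        · intro n _ _; simp
      rwa [this]
    · have : List.ofFn (fun j : Fin l.length => m.get (j.cast hm.symm)) = m := by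
        apply List.ext_get
        · simp [hm]
        · intro n _ _; simp
      rw [tPath_eq, tPath_eq, this, List.ofFn_get]

section
variable {E0 E1 B : Type*} [CStarAlgebra B]
    (r s : E1 → E0) (p : E0 → B) (t : E1 → B)

theorem t_mul_p (hproj : ∀ v, p v * p v = p v ∧ star (p v) = p v)
    (hisom : ∀ e, star (t e) * t e = p (s e)) (e : E1) : t e * p (s e) = t e := by
  have h : star (t e - t e * p (s e)) * (t e - t e * p (s e)) = 0 := by
    rw [star_sub, star_mul, (hproj _).2]
    have : (star (t e) - p (s e) * star (t e)) * (t e - t e * p (s e))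
      = star (t e) * t e - (star (t e) * t e) * p (s e) - p (s e) * (star (t e) * t e)
        + p (s e) * (star (t e) * t e) * p (s e) := by noncomm_ring
    rw [this, hisom, (hproj _).1, (hproj _).1]
    simp
  exact (sub_eq_zero.1 (CStarRing.star_mul_self_eq_zero_iff _ |>.1 h)).symm

theorem TP_cons (hproj : ∀ v, p v * p v = p v ∧ star (p v) = p v)
    (hisom : ∀ e, star (t e) * t e = p (s e))
    (hrange : ∀ e, p (r e) * t e = t e) (e : E1) (l : List E1) :
    TP p t (r e) (e :: l) = t e * TP p t (s e) l := by
  simp only [TP, List.map_cons, List.prod_cons]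
  rw [← mul_assoc, hrange, ← mul_assoc, t_mul_p s p t hproj hisom]

theorem p_TP (hproj : ∀ v, p v * p v = p v ∧ star (p v) = p v) (w : E0) (l : List E1) :
    p w * TP p t w l = TP p t w l := by
  rw [TP, ← mul_assoc, (hproj w).1]

theorem star_TP_mul (hproj : ∀ v, p v * p v = p v ∧ star (p v) = p v)
    (horthp : ∀ v w, v ≠ w → p v * p w = 0)
    (hisom : ∀ e, star (t e) * t e = p (s e))
    (hrange : ∀ e, p (r e) * t e = t e)
    (horth : ∀ e f, e ≠ f → star (t e) * t f = 0) :
    ∀ (m l : List E1) (v w v' w' : E0), m.length ≤ l.length → IsP r s m v w → IsP r s l v' w' →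
      star (TP p t w m) * TP p t w' l = 0 ∨
      ∃ l', IsP r s l' v' v ∧ m.length + l'.length = l.length ∧
        star (TP p t w m) * TP p t w' l = TP p t v l'
  | [], l, v, w, v', w', _, hm, hl => by
    have hm : w = v := hm
    subst hm
    have h0 : star (TP p t w ([] : List E1)) = p w := by simp [TP, (hproj w).2]
    rw [h0]
    by_cases h : w = w'
    · subst h
      exact Or.inr ⟨l, hl, by simp, p_TP p t hproj w l⟩
    · left
      rw [TP, ← mul_assoc, horthp _ _ h, zero_mul]
  | e :: m, [], v, w, v', w', h, _, _ => by simp at h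
  | e :: m, f :: l, v, w, v', w', h, hm, hl => by
    obtain ⟨rfl, hm⟩ := hm
    obtain ⟨rfl, hl⟩ := hl
    rw [TP_cons r s p t hproj hisom hrange, TP_cons r s p t hproj hisom hrange, star_mul]
    have h1 : star (TP p t (s e) m) * star (t e) * (t f * TP p t (s f) l)
      = star (TP p t (s e) m) * (star (t e) * t f) * TP p t (s f) l := by noncomm_ring
    rw [h1]
    by_cases hef : e = f
    · subst hef
      rw [hisom, mul_assoc, p_TP p t hproj]
      rcases star_TP_mul hproj horthp hisom hrange horth m l v (s e) v' (s e)
        (by simpa using h) hm hl with h2 | ⟨l', h2, h3, h4⟩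
      · exact Or.inl h2
      · exact Or.inr ⟨l', h2, by simp; omega, h4⟩
    · left
      rw [horth _ _ hef]; simp

theorem TP_mul_TP (hproj : ∀ v, p v * p v = p v ∧ star (p v) = p v)
    (hisom : ∀ e, star (t e) * t e = p (s e))
    (hrange : ∀ e, p (r e) * t e = t e) :
    ∀ (m l : List E1) (v w v' : E0), IsP r s m v w → IsP r s l v' v →
      IsP r s (m ++ l) v' w ∧ TP p t w m * TP p t v l = TP p t w (m ++ l)
  | [], l, v, w, v', hm, hl => by
    have hm : w = v := hm
    subst hm
    refine ⟨hl, ?_⟩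
    have h0 : TP p t w ([] : List E1) = p w := by simp [TP]
    rw [h0, p_TP p t hproj]; rfl
  | e :: m, l, v, w, v', hm, hl => by
    obtain ⟨rfl, hm⟩ := hm
    obtain ⟨h1, h2⟩ := TP_mul_TP hproj hisom hrange m l v (s e) v' hm hl
    refine ⟨⟨rfl, h1⟩, ?_⟩
    rw [List.cons_append, TP_cons r s p t hproj hisom hrange,
      TP_cons r s p t hproj hisom hrange, ← h2, mul_assoc]

theorem gens_mul (hproj : ∀ v, p v * p v = p v ∧ star (p v) = p v)
    (horthp : ∀ v w, v ≠ w → p v * p w = 0)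
    (hisom : ∀ e, star (t e) * t e = p (s e))
    (hrange : ∀ e, p (r e) * t e = t e)
    (horth : ∀ e f, e ≠ f → star (t e) * t f = 0) {i j : ℕ} (hij : i ≤ j)
    (x y : B) (hx : x ∈ gens r s p t i) (hy : y ∈ gens r s p t j) :
    x * y = 0 ∨ x * y ∈ gens r s p t j := by
  obtain ⟨l, m, v, w, w', rfl, hm, h1, h2, rfl⟩ := hx
  obtain ⟨l', m', v', u, u', rfl, hm', h1', h2', rfl⟩ := hy
  have e1 : TP p t w l * star (TP p t w' m) * (TP p t u l' * star (TP p t u' m'))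
    = TP p t w l * (star (TP p t w' m) * TP p t u l') * star (TP p t u' m') := by noncomm_ring
  rw [e1]
  rcases star_TP_mul r s p t hproj horthp hisom hrange horth m l' v w' v' u (by omega) h2 h1' with
    h | ⟨n, hn, hlen, h⟩
  · left; rw [h]; simp
  · right
    rw [h]
    obtain ⟨h3, h4⟩ := TP_mul_TP r s p t hproj hisom hrange l n v w v' h1 hn
    rw [h4]
    exact ⟨l ++ n, m', v', w, u', by simp; omega, hm', h3, h2', rfl⟩

theorem graphF_closed (i : ℕ) : IsClosed (graphF r s p t i : Set B) :=
  Submodule.isClosed_topologicalClosure _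

theorem gens_sub (i : ℕ) : gens r s p t i ⊆ graphF r s p t i := by
  rw [graphF_eq]
  exact Submodule.subset_span.trans (Submodule.le_topologicalClosure _)

theorem graphF_le (i : ℕ) (S : Submodule ℂ B) (hS : IsClosed (S : Set B))
    (h : gens r s p t i ⊆ S) : graphF r s p t i ≤ S := by
  rw [graphF_eq]
  exact Submodule.topologicalClosure_minimal _ (Submodule.span_le.2 h) hS

theorem graphF_star (i : ℕ) : ∀ x ∈ graphF r s p t i, star x ∈ graphF r s p t i := by
  have hcl : IsClosed {x : B | star x ∈ (graphF r s p t i : Set B)} :=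
    (graphF_closed r s p t i).preimage continuous_star
  let S : Submodule ℂ B :=
    { carrier := {x : B | star x ∈ (graphF r s p t i : Set B)}
      add_mem' := fun {a b} ha hb => by
        simp only [Set.mem_ofPred_eq, star_add]
        exact (graphF r s p t i).add_mem ha hb
      zero_mem' := by simp
      smul_mem' := fun c x hx => by
        simp only [Set.mem_ofPred_eq, star_smul]
        exact (graphF r s p t i).smul_mem _ hx }
  refine graphF_le r s p t i S hcl ?_
  rintro x ⟨l, m, v, w, w', h1, h2, h3, h4, rfl⟩
  exact gens_sub r s p t i ⟨m, l, v, w', w, h2, h1, h4, h3, by simp⟩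

theorem graphF_mul (hproj : ∀ v, p v * p v = p v ∧ star (p v) = p v)
    (horthp : ∀ v w, v ≠ w → p v * p w = 0)
    (hisom : ∀ e, star (t e) * t e = p (s e))
    (hrange : ∀ e, p (r e) * t e = t e)
    (horth : ∀ e f, e ≠ f → star (t e) * t f = 0) {i j : ℕ} (hij : i ≤ j) :
    ∀ x ∈ graphF r s p t i, ∀ y ∈ graphF r s p t j, x * y ∈ graphF r s p t j := by
  have hc := graphF_closed r s p t j
  have step1 : ∀ x ∈ gens r s p t i, ∀ y ∈ graphF r s p t j, x * y ∈ graphF r s p t j := by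
    intro x hx
    refine graphF_le r s p t j ((graphF r s p t j).comap (LinearMap.mulLeft ℂ x)) ?_ ?_
    · exact hc.preimage (continuous_const_mul x)
    · intro y hy
      change x * y ∈ graphF r s p t j
      rcases gens_mul r s p t hproj horthp hisom hrange horth hij x y hx hy with h | h
      · rw [h]; exact Submodule.zero_mem _
      · exact gens_sub r s p t j h
  intro x hx y hy
  refine graphF_le r s p t i ((graphF r s p t j).comap (LinearMap.mulRight ℂ y)) ?_ ?_ hx
  · exact hc.preimage (continuous_mul_const y)
  · intro x hx
    exact step1 x hx y hy

theorem graphF_mul' (hproj : ∀ v, p v * p v = p v ∧ star (p v) = p v)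
    (horthp : ∀ v w, v ≠ w → p v * p w = 0)
    (hisom : ∀ e, star (t e) * t e = p (s e))
    (hrange : ∀ e, p (r e) * t e = t e)
    (horth : ∀ e f, e ≠ f → star (t e) * t f = 0) {i j : ℕ} (hij : i ≤ j) :
    ∀ x ∈ graphF r s p t i, ∀ y ∈ graphF r s p t j, y * x ∈ graphF r s p t j := by
  intro x hx y hy
  have := graphF_star r s p t j _ (graphF_mul r s p t hproj horthp hisom hrange horth hij _
    (graphF_star r s p t i x hx) _ (graphF_star r s p t j y hy))
  simpa using this

theorem graphC_zero : graphC r s p t 0 = graphF r s p t 0 := by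
  apply le_antisymm
  · refine iSup_le fun k => ?_
    have hk : (k : ℕ) = 0 := by omega
    rw [hk]
  · exact le_iSup (fun k : Fin (0 + 1) => graphF r s p t (k : ℕ)) 0

theorem graphF_le_graphC {i j : ℕ} (h : i ≤ j) : graphF r s p t i ≤ graphC r s p t j :=
  le_iSup (fun k : Fin (j + 1) => graphF r s p t (k : ℕ)) ⟨i, by omega⟩

theorem graphC_le {i : ℕ} {S : Submodule ℂ B} (h : ∀ j ≤ i, graphF r s p t j ≤ S) :
    graphC r s p t i ≤ S :=
  iSup_le fun k => h k (by omega)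

theorem graphC_mono {i j : ℕ} (h : i ≤ j) : graphC r s p t i ≤ graphC r s p t j :=
  graphC_le r s p t fun _ hk => graphF_le_graphC r s p t (hk.trans h)

theorem graphC_succ (i : ℕ) :
    graphC r s p t (i + 1) = graphC r s p t i ⊔ graphF r s p t (i + 1) := by
  apply le_antisymm
  · apply graphC_le
    intro j hj
    rcases Nat.lt_or_eq_of_le hj with h | rfl
    · exact (graphF_le_graphC r s p t (by omega)).trans le_sup_left
    · exact le_sup_right
  · exact sup_le (graphC_mono r s p t (by omega)) (graphF_le_graphC r s p t le_rfl)

theorem graphC_props (hproj : ∀ v, p v * p v = p v ∧ star (p v) = p v)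
    (horthp : ∀ v w, v ≠ w → p v * p w = 0)
    (hisom : ∀ e, star (t e) * t e = p (s e))
    (hrange : ∀ e, p (r e) * t e = t e)
    (horth : ∀ e f, e ≠ f → star (t e) * t f = 0) (i : ℕ) :
    IsClosed (graphC r s p t i : Set B) ∧
    (∀ x ∈ graphC r s p t i, ∀ y ∈ graphC r s p t i, x * y ∈ graphC r s p t i) ∧
    (∀ x ∈ graphC r s p t i, star x ∈ graphC r s p t i) := by
  induction i with
  | zero =>
    rw [graphC_zero]
    exact ⟨graphF_closed r s p t 0,
      graphF_mul r s p t hproj horthp hisom hrange horth le_rfl, graphF_star r s p t 0⟩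
  | succ i ih =>
    obtain ⟨h1, h2, h3⟩ := ih
    have hFm := graphF_mul r s p t hproj horthp hisom hrange horth (le_refl (i + 1))
    have hFs := graphF_star r s p t (i + 1)
    have hCF : ∀ x ∈ graphC r s p t i, ∀ y ∈ graphF r s p t (i + 1),
        x * y ∈ graphF r s p t (i + 1) := by
      intro x hx y hy
      refine graphC_le r s p t (S := (graphF r s p t (i + 1)).comap (LinearMap.mulRight ℂ y))
        (fun j hj x hx => ?_) hx
      exact graphF_mul r s p t hproj horthp hisom hrange horth (by omega) x hx y hy
    have hFC : ∀ x ∈ graphC r s p t i, ∀ y ∈ graphF r s p t (i + 1),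
        y * x ∈ graphF r s p t (i + 1) := by
      intro x hx y hy
      simpa using hFs _ (hCF _ (h3 x hx) _ (hFs y hy))
    rw [graphC_succ]
    refine ⟨isClosed_sup _ _ h3 h1 h2 hFs (graphF_closed r s p t (i + 1)) hFm hCF, ?_, ?_⟩
    · intro x hx y hy
      obtain ⟨a, ha, b, hb, rfl⟩ := Submodule.mem_sup.1 hx
      obtain ⟨c, hc, d, hd, rfl⟩ := Submodule.mem_sup.1 hy
      have e : (a + b) * (c + d) = a * c + (a * d + b * c + b * d) := by noncomm_ring
      rw [e]
      exact Submodule.add_mem_sup (h2 _ ha _ hc) (Submodule.add_mem _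
        (Submodule.add_mem _ (hCF _ ha _ hd) (hFC _ hc _ hb)) (hFm _ hb _ hd))
    · intro x hx
      obtain ⟨a, ha, b, hb, rfl⟩ := Submodule.mem_sup.1 hx
      rw [star_add]
      exact Submodule.add_mem_sup (h3 _ ha) (hFs _ hb)

theorem iSup_graphC : (⨆ i, graphF r s p t i) = ⨆ i, graphC r s p t i := by
  apply le_antisymm
  · exact iSup_mono fun i => graphF_le_graphC r s p t le_rfl
  · exact iSup_le fun i => graphC_le r s p t fun j _ => le_iSup (fun k => graphF r s p t k) j

end

/-- Let `E` be an arbitrary directed graph and `{t_e, p_v}` a Cuntz–Krieger `E`-family in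
a C*-algebra `B`.  Then each `C_i = F_0 + ⋯ + F_i` is a C*-subalgebra (a closed,
*-closed, multiplicatively closed subspace) of the core, `C_i ⊆ C_{i+1}`, and
`⋃_i C_i` is dense in the core `C*(E)^γ` (the closed span of `{t_μ t_ν* : |μ|=|ν|}`,
which is the fixed-point algebra of the gauge action). -/
theorem stmt13 {E0 E1 B : Type*} [CStarAlgebra B]
    (r s : E1 → E0) (p : E0 → B) (t : E1 → B)
    (hproj : ∀ v, p v * p v = p v ∧ star (p v) = p v)
    (horthp : ∀ v w, v ≠ w → p v * p w = 0)
    (hisom : ∀ e, star (t e) * t e = p (s e))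
    (hrange : ∀ e, p (r e) * t e = t e)
    (horth : ∀ e f, e ≠ f → star (t e) * t f = 0)
    (hCK : ∀ v : E0, ({e : E1 | r e = v}).Finite → ({e : E1 | r e = v}).Nonempty →
      ∀ rfin : Finset E1, (∀ e, e ∈ rfin ↔ r e = v) →
        p v = ∑ e ∈ rfin, t e * star (t e)) :
    ∀ i : ℕ,
      IsClosed ((graphC r s p t i : Submodule ℂ B) : Set B) ∧
      (∀ x ∈ graphC r s p t i, ∀ y ∈ graphC r s p t i, x * y ∈ graphC r s p t i) ∧
      (∀ x ∈ graphC r s p t i, star x ∈ graphC r s p t i) ∧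
      graphC r s p t i ≤ graphC r s p t (i + 1) ∧
      graphC r s p t i ≤ graphCore r s p t ∧
      closure (⋃ j : ℕ, ((graphC r s p t j : Submodule ℂ B) : Set B))
        = ((graphCore r s p t : Submodule ℂ B) : Set B) := by
  intro i
  obtain ⟨h1, h2, h3⟩ := graphC_props r s p t hproj horthp hisom hrange horth i
  refine ⟨h1, h2, h3, graphC_mono r s p t (by omega), ?_, ?_⟩
  · unfold graphCore
    refine le_trans ?_ (Submodule.le_topologicalClosure _)
    rw [iSup_graphC]
    exact le_iSup (fun k => graphC r s p t k) i
  · unfold graphCore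
    rw [iSup_graphC, Submodule.topologicalClosure_coe, Submodule.coe_iSup_of_directed]
    exact Monotone.directed_le fun _ _ h => graphC_mono r s p t h
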